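/- arXiv:2111.06789 — 2 statements merged into one kernel-verified Lean document; each statement's English description precedes it below -/
import Mathlib

section
/- Let 𝔼₁ and 𝔼₂ be finite-dimensional Banach spaces, N : [0,1] × 𝔼₁ → [0,∞) a continuous function that is a norm on 𝔼₁ for each t ∈ [0,1], and π : [0,1] × 𝔼₁ → 𝔼₂ a continuous function that is linear in the second variable for each t. If v : [0,1] → 𝔼₂ is a Borel function with v(t) ∈ π(t, 𝔼₁) for almost every t, then there exists a Borel function u : [0,1] → 𝔼₁ such that for almost every t: π(t, u(t)) = v(t) and N(t, u(t)) = inf{ N(t, w) : w ∈ 𝔼₁, π(t, w) = v(t) }. -/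
open MeasureTheory Set

/-- For a function measurable in `t` and continuous in `x`, the set of `t` for which the sublevel
set `{x | g t x ≤ 0}` meets a given compact set is measurable. -/
theorem measurableSet_exists_le_zero_of_isCompact {T E : Type*} [MeasurableSpace T]
    [PseudoMetricSpace E] [SecondCountableTopology E] {g : T → E → ℝ}
    (hgm : ∀ x, Measurable fun t => g t x) (hgc : ∀ t, Continuous (g t))
    {C : Set E} (hC : IsCompact C) : MeasurableSet {t | ∃ x ∈ C, g t x ≤ 0} := by
  obtain ⟨D, hDC, hDcount, hCD⟩ :=
    (TopologicalSpace.IsSeparable.of_separableSpace C).exists_countable_dense_subset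
  have key : {t | ∃ x ∈ C, g t x ≤ 0} =
      ⋂ n : ℕ, ⋃ x ∈ D, {t | g t x < 1 / ((n : ℝ) + 1)} := by
    ext t
    simp only [mem_ofPred_eq, mem_iInter, mem_iUnion, exists_prop]
    constructor
    · rintro ⟨x, hxC, hx⟩ n
      have hopen : IsOpen {y | g t y < 1 / ((n : ℝ) + 1)} :=
        isOpen_lt (hgc t) continuous_const
      have hmem : x ∈ {y | g t y < 1 / ((n : ℝ) + 1)} :=
        lt_of_le_of_lt hx Nat.one_div_pos_of_nat
      obtain ⟨y, hy, hyD⟩ := mem_closure_iff.1 (hCD hxC) _ hopen hmem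
      exact ⟨y, hyD, hy⟩
    · intro h
      obtain ⟨y, hyD, -⟩ := h 0
      obtain ⟨x, hxC, hx⟩ := hC.exists_isMinOn ⟨y, hDC hyD⟩ (hgc t).continuousOn
      refine ⟨x, hxC, le_of_forall_pos_lt_add fun ε hε => ?_⟩
      obtain ⟨n, hn⟩ := exists_nat_one_div_lt hε
      obtain ⟨z, hzD, hz⟩ := h n
      have := isMinOn_iff.1 hx z (hDC hzD)
      linarith
  rw [key]
  exact MeasurableSet.iInter fun n => MeasurableSet.biUnion hDcount fun x _ =>
    measurableSet_lt (hgm x) measurable_const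

/-- For a function measurable in `t` and continuous in `x`, the set of `t` for which the sublevel
set `{x | g t x ≤ 0}` meets a given closed set is measurable. -/
theorem measurableSet_exists_le_zero_of_isClosed {T E : Type*} [MeasurableSpace T]
    [PseudoMetricSpace E] [ProperSpace E] {g : T → E → ℝ}
    (hgm : ∀ x, Measurable fun t => g t x) (hgc : ∀ t, Continuous (g t))
    {C : Set E} (hC : IsClosed C) : MeasurableSet {t | ∃ x ∈ C, g t x ≤ 0} := by
  have key : {t | ∃ x ∈ C, g t x ≤ 0} =
      ⋃ n : ℕ, {t | ∃ x ∈ compactCovering E n ∩ C, g t x ≤ 0} := by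
    ext t
    simp only [mem_ofPred_eq, mem_iUnion, mem_inter_iff]
    constructor
    · rintro ⟨x, hxC, hx⟩
      obtain ⟨n, hn⟩ := exists_mem_compactCovering x
      exact ⟨n, x, ⟨hn, hxC⟩, hx⟩
    · rintro ⟨n, x, ⟨-, hxC⟩, hx⟩
      exact ⟨x, hxC, hx⟩
  rw [key]
  exact MeasurableSet.iUnion fun n => measurableSet_exists_le_zero_of_isCompact hgm hgc
    ((isCompact_compactCovering E n).inter_right hC)

/-- If `h t` attains its minimum on the sublevel set `{x | g t x ≤ 0}` for every `t`, then the sets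
of minimizers are again sublevel sets of a nonnegative function measurable in `t` and continuous
in `x`. -/
theorem exists_le_zero_iff_isMinOn {T E : Type*} [MeasurableSpace T]
    [PseudoMetricSpace E] [ProperSpace E] {g h : T → E → ℝ}
    (hgm : ∀ x, Measurable fun t => g t x) (hgc : ∀ t, Continuous (g t))
    (hg0 : ∀ t x, 0 ≤ g t x)
    (hhm : ∀ x, Measurable fun t => h t x) (hhc : ∀ t, Continuous (h t))
    (hmin : ∀ t, ∃ x ∈ {x | g t x ≤ 0}, IsMinOn (h t) {x | g t x ≤ 0} x) :
    ∃ k : T → E → ℝ, (∀ x, Measurable fun t => k t x) ∧ (∀ t, Continuous (k t)) ∧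
      (∀ t x, 0 ≤ k t x) ∧
      ∀ t x, k t x ≤ 0 ↔ g t x ≤ 0 ∧ IsMinOn (h t) {x | g t x ≤ 0} x := by
  choose x₀ hx₀ hx₀min using hmin
  have split : ∀ t x a, g t x + max (h t x - a) 0 ≤ 0 ↔ g t x ≤ 0 ∧ h t x ≤ a := by
    intro t x a
    have h1 := hg0 t x
    have h2 := le_max_left (h t x - a) 0
    have h3 := le_max_right (h t x - a) 0
    constructor
    · intro h4
      constructor <;> linarith
    · rintro ⟨h4, h5⟩
      have : max (h t x - a) 0 ≤ 0 := max_le (by linarith) le_rfl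
      linarith
  have hm : Measurable fun t => h t (x₀ t) := by
    refine measurable_of_Iic fun a => ?_
    have key : (fun t => h t (x₀ t)) ⁻¹' Iic a =
        {t | ∃ x ∈ (univ : Set E), g t x + max (h t x - a) 0 ≤ 0} := by
      ext t
      simp only [mem_preimage, mem_Iic, mem_ofPred_eq, mem_univ, true_and, split]
      exact ⟨fun ht => ⟨x₀ t, hx₀ t, ht⟩,
        fun ⟨x, hx, hxa⟩ => (isMinOn_iff.1 (hx₀min t) x hx).trans hxa⟩
    rw [key]
    exact measurableSet_exists_le_zero_of_isClosed
      (fun x => (hgm x).add (((hhm x).sub_const a).max measurable_const))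
      (fun t => (hgc t).add (((hhc t).sub continuous_const).max continuous_const)) isClosed_univ
  refine ⟨fun t x => g t x + max (h t x - h t (x₀ t)) 0,
    fun x => (hgm x).add (((hhm x).sub hm).max measurable_const),
    fun t => (hgc t).add (((hhc t).sub continuous_const).max continuous_const),
    fun t x => add_nonneg (hg0 t x) (le_max_right _ _), fun t x => ?_⟩
  rw [split]
  exact and_congr_right fun _ => ⟨fun hx => isMinOn_iff.2 fun y hy =>
    hx.trans (isMinOn_iff.1 (hx₀min t) y hy), fun hx => isMinOn_iff.1 hx _ (hx₀ t)⟩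

/-- A continuous, absolutely homogeneous function on a proper space that is positive away from the
origin attains its minimum on every nonempty closed set. -/
theorem IsClosed.exists_isMinOn_of_abs_homogeneous {E : Type*} [NormedAddCommGroup E]
    [NormedSpace ℝ E] [ProperSpace E] {p : E → ℝ} (hc : Continuous p)
    (hpos : ∀ x, x ≠ 0 → 0 < p x) (hsmul : ∀ (c : ℝ) x, p (c • x) = |c| * p x)
    {K : Set E} (hK : IsClosed K) (hne : K.Nonempty) : ∃ x ∈ K, IsMinOn p K x := by
  obtain ⟨c, hc0, hcp⟩ : ∃ c > 0, ∀ x, c * ‖x‖ ≤ p x := by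
    have hp0 : p 0 = 0 := by simpa using hsmul 0 0
    rcases (Metric.sphere (0 : E) 1).eq_empty_or_nonempty with hs | hs
    · refine ⟨1, one_pos, fun x => ?_⟩
      by_cases hx : x = 0
      · simp [hx, hp0]
      · have : ‖x‖⁻¹ • x ∈ Metric.sphere (0 : E) 1 := by simp [norm_smul, hx]
        simp [hs] at this
    · obtain ⟨y, hy, hymin⟩ := (isCompact_sphere (0 : E) 1).exists_isMinOn hs hc.continuousOn
      refine ⟨p y, hpos y (ne_zero_of_mem_unit_sphere ⟨y, hy⟩), fun x => ?_⟩
      by_cases hx : x = 0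
      · simp [hx, hp0]
      · have hmem : ‖x‖⁻¹ • x ∈ Metric.sphere (0 : E) 1 := by simp [norm_smul, hx]
        have hle := isMinOn_iff.1 hymin _ hmem
        have hxpos : 0 < ‖x‖ := norm_pos_iff.2 hx
        rw [hsmul, abs_of_pos (inv_pos.2 hxpos), inv_mul_eq_div, le_div_iff₀ hxpos] at hle
        exact hle
  obtain ⟨x₀, hx₀⟩ := hne
  have htend : Filter.Tendsto p (Filter.cocompact E) Filter.atTop :=
    Filter.tendsto_atTop_mono hcp ((tendsto_norm_cocompact_atTop (E := E)).const_mul_atTop hc0)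
  exact hc.continuousOn.exists_isMinOn' hK hx₀
    (Filter.Eventually.filter_mono inf_le_left (htend.eventually_ge_atTop (p x₀)))

/-- If the sublevel sets `{x | g t x ≤ 0}` of a function measurable in `t` and continuous in `x`
are nonempty and convex, then they admit a measurable selection. -/
theorem exists_measurable_selection_of_convex {T E : Type*} [MeasurableSpace T]
    [NormedAddCommGroup E] [NormedSpace ℝ E] [FiniteDimensional ℝ E]
    [MeasurableSpace E] [BorelSpace E] {g : T → E → ℝ}
    (hgm : ∀ x, Measurable fun t => g t x) (hgc : ∀ t, Continuous (g t))
    (hg0 : ∀ t x, 0 ≤ g t x) (hne : ∀ t, {x | g t x ≤ 0}.Nonempty)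
    (hconv : ∀ t, Convex ℝ {x | g t x ≤ 0}) :
    ∃ u : T → E, Measurable u ∧ ∀ t, g t (u t) ≤ 0 := by
  have : ProperSpace E := FiniteDimensional.proper ℝ E
  have hhc : Continuous fun x : E => ‖toEuclidean x‖ := toEuclidean.continuous.norm
  have hmin : ∀ t, ∃ x ∈ {x | g t x ≤ 0},
      IsMinOn (fun x : E => ‖toEuclidean x‖) {x | g t x ≤ 0} x := fun t =>
    (isClosed_le (hgc t) continuous_const).exists_isMinOn_of_abs_homogeneous hhc
      (fun x hx => norm_pos_iff.2 (by simpa using hx))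
      (fun c x => by rw [map_smul, norm_smul, Real.norm_eq_abs]) (hne t)
  obtain ⟨k, hkm, hkc, -, hk⟩ := exists_le_zero_iff_isMinOn hgm hgc hg0
    (h := fun _ x => ‖toEuclidean x‖) (fun x => measurable_const) (fun _ => hhc) hmin
  have huniq : ∀ t x y, k t x ≤ 0 → k t y ≤ 0 → x = y := by
    intro t x y hx hy
    rw [hk] at hx hy
    have hxy := le_antisymm (isMinOn_iff.1 hx.2 y hy.1) (isMinOn_iff.1 hy.2 x hx.1)
    have hmid := isMinOn_iff.1 hx.2 _
      (hconv t hx.1 hy.1 (a := 1 / 2) (b := 1 / 2) (by norm_num) (by norm_num) (by norm_num))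
    by_contra hne
    have hne' : toEuclidean x ≠ toEuclidean y := fun h => hne (toEuclidean.injective h)
    have hlt := norm_combo_lt_of_ne (le_refl ‖toEuclidean x‖) hxy.ge hne'
      (a := 1 / 2) (b := 1 / 2) (by norm_num) (by norm_num) (by norm_num)
    rw [map_add, map_smul, map_smul] at hmid
    exact absurd hmid (not_le.2 hlt)
  choose u hu humin using hmin
  have hku : ∀ t, k t (u t) ≤ 0 := fun t => (hk t _).2 ⟨hu t, humin t⟩
  refine ⟨u, measurable_of_isClosed fun C hC => ?_, hu⟩
  have key : u ⁻¹' C = {t | ∃ x ∈ C, k t x ≤ 0} := by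
    ext t
    exact ⟨fun ht => ⟨u t, ht, hku t⟩, fun ⟨x, hxC, hx⟩ =>
      mem_preimage.2 (huniq t x (u t) hx (hku t) ▸ hxC)⟩
  rw [key]
  exact measurableSet_exists_le_zero_of_isClosed hkm hkc hC

/-- Measurable selection of minimal-norm preimages for a family of norms and linear maps that
depend measurably on a parameter. -/
theorem exists_measurable_isMinOn_preimage {T E F : Type*} [MeasurableSpace T]
    [NormedAddCommGroup E] [NormedSpace ℝ E] [FiniteDimensional ℝ E]
    [MeasurableSpace E] [BorelSpace E]
    [NormedAddCommGroup F] [NormedSpace ℝ F] [FiniteDimensional ℝ F]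
    [MeasurableSpace F] [BorelSpace F]
    {N : T → E → ℝ} (hNm : ∀ x, Measurable fun t => N t x) (hNc : ∀ t, Continuous (N t))
    (hNpos : ∀ t x, x ≠ 0 → 0 < N t x)
    (hNsmul : ∀ t (c : ℝ) x, N t (c • x) = |c| * N t x)
    (hNadd : ∀ t x y, N t (x + y) ≤ N t x + N t y)
    {L : T → E →ₗ[ℝ] F} (hLm : ∀ x, Measurable fun t => L t x)
    {v : T → F} (hv : Measurable v) (hrange : ∀ t, v t ∈ range (L t)) :
    ∃ u : T → E, Measurable u ∧
      ∀ t, L t (u t) = v t ∧ IsMinOn (N t) {x | L t x = v t} (u t) := by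
  have : ProperSpace E := FiniteDimensional.proper ℝ E
  have : ProperSpace F := FiniteDimensional.proper ℝ F
  have hzero : ∀ t x, ‖L t x - v t‖ ≤ 0 ↔ L t x = v t := fun t x => by
    rw [norm_le_zero_iff, sub_eq_zero]
  have hgm : ∀ x, Measurable fun t => ‖L t x - v t‖ := fun x => ((hLm x).sub hv).norm
  have hgc : ∀ t, Continuous fun x => ‖L t x - v t‖ := fun t =>
    ((L t).continuous_of_finiteDimensional.sub continuous_const).norm
  have hmin : ∀ t, ∃ x ∈ {x | ‖L t x - v t‖ ≤ 0}, IsMinOn (N t) {x | ‖L t x - v t‖ ≤ 0} x := by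
    intro t
    obtain ⟨x, hx⟩ := hrange t
    exact (isClosed_le (hgc t) continuous_const).exists_isMinOn_of_abs_homogeneous (hNc t)
      (hNpos t) (hNsmul t) ⟨x, (hzero t x).2 hx⟩
  obtain ⟨k, hkm, hkc, hk0, hk⟩ := exists_le_zero_iff_isMinOn hgm hgc
    (fun _ _ => norm_nonneg _) hNm hNc hmin
  simp only [hzero] at hk hmin
  obtain ⟨u, hum, hu⟩ := exists_measurable_selection_of_convex hkm hkc hk0
    (fun t => (hmin t).imp fun x hx => (hk t x).2 hx) (fun t x hx y hy a b ha hb hab => by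
      simp only [mem_ofPred_eq, hk] at hx hy ⊢
      refine ⟨by rw [map_add, map_smul, map_smul, hx.1, hy.1, ← add_smul, hab, one_smul],
        isMinOn_iff.2 fun z hz => ?_⟩
      calc N t (a • x + b • y) ≤ a * N t x + b * N t y := by
            simpa only [hNsmul, abs_of_nonneg ha, abs_of_nonneg hb] using hNadd t (a • x) (b • y)
        _ ≤ a * N t z + b * N t z := by
            gcongr
            · exact isMinOn_iff.1 hx.2 z hz
            · exact isMinOn_iff.1 hy.2 z hz
        _ = N t z := by rw [← add_mul, hab, one_mul])
  exact ⟨u, hum, fun t => (hk t _).1 (hu t)⟩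

/-- Measurable selection of minimal-norm preimages: if `v(t) ∈ π(t, 𝔼₁)`
a.e., then there is a Borel function `u` with `π(t, u(t)) = v(t)` and
`N(t, u(t)) = inf { N(t,w) : π(t,w) = v(t) }` almost everywhere. -/
theorem stmt_7 {E1 E2 : Type*}
    [NormedAddCommGroup E1] [NormedSpace ℝ E1] [FiniteDimensional ℝ E1]
    [MeasurableSpace E1] [BorelSpace E1]
    [NormedAddCommGroup E2] [NormedSpace ℝ E2] [FiniteDimensional ℝ E2]
    [MeasurableSpace E2] [BorelSpace E2]
    (N : ℝ → E1 → ℝ)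
    (hNc : ContinuousOn (Function.uncurry N) (Set.Icc 0 1 ×ˢ Set.univ))
    (hN0 : ∀ t ∈ Set.Icc (0:ℝ) 1, ∀ v : E1, 0 ≤ N t v)
    (hNeq : ∀ t ∈ Set.Icc (0:ℝ) 1, ∀ v : E1, N t v = 0 ↔ v = 0)
    (hNsmul : ∀ t ∈ Set.Icc (0:ℝ) 1, ∀ (c : ℝ) (v : E1), N t (c • v) = |c| * N t v)
    (hNadd : ∀ t ∈ Set.Icc (0:ℝ) 1, ∀ v w : E1, N t (v + w) ≤ N t v + N t w)
    (π : ℝ → E1 →ₗ[ℝ] E2)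
    (hπc : ContinuousOn (fun p : ℝ × E1 => π p.1 p.2) (Set.Icc 0 1 ×ˢ Set.univ))
    (v : ℝ → E2) (hv : Measurable v)
    (hrange : ∀ᵐ t ∂(volume.restrict (Set.Icc (0:ℝ) 1)), v t ∈ Set.range (π t)) :
    ∃ u : ℝ → E1, Measurable u ∧
      ∀ᵐ t ∂(volume.restrict (Set.Icc (0:ℝ) 1)),
        π t (u t) = v t ∧
        N t (u t) = sInf { r : ℝ | ∃ z : E1, π t z = v t ∧ r = N t z } := by
  obtain ⟨S, hSsub, hSm, hSae⟩ : ∃ S ⊆ {t | t ∈ Icc (0 : ℝ) 1 ∧ v t ∈ range (π t)},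
      MeasurableSet S ∧ ∀ᵐ t ∂(volume.restrict (Icc (0 : ℝ) 1)), t ∈ S := by
    have hae : {t | t ∈ Icc (0 : ℝ) 1 ∧ v t ∈ range (π t)} ∈
        ae (volume.restrict (Icc (0 : ℝ) 1)) :=
      (ae_restrict_mem measurableSet_Icc).and hrange
    obtain ⟨S, hS, hSm, hSsub⟩ := Filter.Eventually.exists_measurable_mem hae
    exact ⟨S, hSsub, hSm, hS⟩
  have hSI : ∀ t : S, (t : ℝ) ∈ Icc (0 : ℝ) 1 := fun t => (hSsub t.2).1
  have hslice : ∀ x : E1, Continuous fun t : S => ((t : ℝ), x) := fun x => by fun_prop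
  obtain ⟨u, hum, hu⟩ := exists_measurable_isMinOn_preimage
    (T := S) (N := fun t => N t) (L := fun t => π t) (v := fun t => v t)
    (fun x => (hNc.comp_continuous (hslice x) fun t => ⟨hSI t, mem_univ _⟩).measurable)
    (fun t => hNc.comp_continuous (Continuous.prodMk_right (t : ℝ)) fun x => ⟨hSI t, mem_univ _⟩)
    (fun t x hx => (hN0 t (hSI t) x).lt_of_ne fun h => hx ((hNeq t (hSI t) x).1 h.symm))
    (fun t => hNsmul t (hSI t)) (fun t => hNadd t (hSI t))
    (fun x => (hπc.comp_continuous (hslice x) fun t => ⟨hSI t, mem_univ _⟩).measurable)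
    (hv.comp measurable_subtype_coe) (fun t => (hSsub t.2).2)
  obtain ⟨w, hwm, hw⟩ := (MeasurableEmbedding.subtype_coe hSm).exists_measurable_extend hum
    fun _ => ⟨0⟩
  refine ⟨w, hwm, hSae.mono fun t ht => ?_⟩
  have hwt : w t = u ⟨t, ht⟩ := congrFun hw ⟨t, ht⟩
  obtain ⟨hsol, hmin⟩ := hu ⟨t, ht⟩
  rw [hwt]
  refine ⟨hsol, Eq.symm (IsLeast.csInf_eq ⟨⟨_, hsol, rfl⟩, ?_⟩)⟩
  rintro r ⟨z, hz, rfl⟩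
  exact isMinOn_iff.1 hmin z hz
end

section
/- Let Ω ⊆ ℝ^m be an open set containing 0, and let f : Ω → ℝ^m be a topological embedding with f(0) = 0. Let r > 0 be such that the closed ball B̄(0,r) ⊆ Ω, and define φ : 𝕊^{m−1} → 𝕊^{m−1} by φ(x) := f(rx)/|f(rx)|. Then deg(φ) ∈ {−1, 1}. -/
open Set Topology Metric

section Normalization

variable {E : Type*} [NormedAddCommGroup E] [NormedSpace ℝ E]

theorem exists_normalization {X : Type*} [TopologicalSpace X] {u : X → E} (hu : Continuous u)
    (hne : ∀ x, u x ≠ 0) : ∃ g : C(X, sphere (0 : E) 1), ∀ x, (g x : E) = ‖u x‖⁻¹ • u x := by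
  have hmem : ∀ x, ‖u x‖⁻¹ • u x ∈ sphere (0 : E) 1 := fun x => by simp [norm_smul, hne x]
  have hc : Continuous fun x => ‖u x‖⁻¹ • u x :=
    (hu.norm.inv₀ fun x => norm_ne_zero_iff.2 (hne x)).smul hu
  exact ⟨⟨fun x => ⟨_, hmem x⟩, hc.subtype_mk hmem⟩, fun _ => rfl⟩

/-- Two maps into the unit sphere that are the normalizations of the two ends of a nowhere
vanishing homotopy are homotopic. -/
theorem homotopic_of_forall_ne_zero {X : Type*} [TopologicalSpace X]
    {g₀ g₁ : C(X, sphere (0 : E) 1)} (F : unitInterval × X → E) (hF : Continuous F)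
    (hne : ∀ p, F p ≠ 0) (h₀ : ∀ x, (g₀ x : E) = ‖F (0, x)‖⁻¹ • F (0, x))
    (h₁ : ∀ x, (g₁ x : E) = ‖F (1, x)‖⁻¹ • F (1, x)) : g₀.Homotopic g₁ := by
  obtain ⟨H, hH⟩ := exists_normalization hF hne
  exact ⟨⟨H, fun x => Subtype.ext ((hH _).trans (h₀ x).symm),
    fun x => Subtype.ext ((hH _).trans (h₁ x).symm)⟩⟩

theorem homotopic_of_id_homotopic_const {X Y : Type*} [TopologicalSpace X] [TopologicalSpace Y]
    {p : Y} (h : (ContinuousMap.id Y).Homotopic (ContinuousMap.const Y p)) (a b : C(X, Y)) :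
    a.Homotopic b :=
  (h.comp (.refl a)).trans (h.comp (.refl b)).symm

/-- If the image of a ball under an embedding fixing the centre is a neighbourhood of the centre,
then the normalized boundary map is a homotopy equivalence. -/
theorem exists_homotopyInverse_of_image_mem_nhds {f G : E → E} {r : ℝ} (hr : 0 < r)
    (hf : ContinuousOn f (closedBall 0 r)) (hG : Continuous G)
    (hGf : ∀ x ∈ closedBall (0 : E) r, G (f x) = x) (hf0 : f 0 = 0)
    (hnhds : f '' closedBall 0 r ∈ 𝓝 0) (φ : C(sphere (0 : E) 1, sphere (0 : E) 1))
    (hφ : ∀ x, (φ x : E) = ‖f (r • (x : E))‖⁻¹ • f (r • (x : E))) :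
    ∃ ψ : C(sphere (0 : E) 1, sphere (0 : E) 1),
      (φ.comp ψ).Homotopic (ContinuousMap.id _) ∧
      (ψ.comp φ).Homotopic (ContinuousMap.id _) := by
  obtain ⟨ε, hε, hεf⟩ := nhds_basis_closedBall.mem_iff.1 hnhds
  have hfG : ∀ y ∈ closedBall (0 : E) ε, G y ∈ closedBall 0 r ∧ f (G y) = y := by
    intro y hy
    obtain ⟨x, hx, rfl⟩ := hεf hy
    rw [hGf x hx]
    exact ⟨hx, rfl⟩
  have hG0 : ∀ y ∈ closedBall (0 : E) ε, y ≠ 0 → G y ≠ 0 := by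
    intro y hy hy0 h
    apply hy0
    rw [← (hfG y hy).2, h, hf0]
  have hfne : ∀ x ∈ closedBall (0 : E) r, x ≠ 0 → f x ≠ 0 := by
    intro x hx hx0 h
    apply hx0
    rw [← hGf x hx, h]
    simpa [hf0] using hGf 0 (by simp [hr.le])
  have hsph : ∀ x : sphere (0 : E) 1, ‖(x : E)‖ = 1 := fun x => by simp
  have hsph0 : ∀ x : sphere (0 : E) 1, (x : E) ≠ 0 := fun x =>
    norm_ne_zero_iff.1 (by rw [hsph]; exact one_ne_zero)
  have hmem : ∀ y : sphere (0 : E) 1, ε • (y : E) ∈ closedBall (0 : E) ε := fun y => by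
    simp [norm_smul, abs_of_pos hε]
  have hu0 : ∀ y : sphere (0 : E) 1, G (ε • (y : E)) ≠ 0 := fun y =>
    hG0 _ (hmem y) (smul_ne_zero hε.ne' (hsph0 y))
  have hGc : Continuous fun y : sphere (0 : E) 1 => G (ε • (y : E)) := by fun_prop
  obtain ⟨ψ, hψ⟩ := exists_normalization hGc hu0
  refine ⟨ψ, ?_, ?_⟩
  · let s : unitInterval × sphere (0 : E) 1 → ℝ := fun p =>
      (1 - (p.1 : ℝ)) * (r * ‖G (ε • (p.2 : E))‖⁻¹) + p.1
    have hs : Continuous s := by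
      have := (hGc.norm.inv₀ fun y => norm_ne_zero_iff.2 (hu0 y)).comp
        (continuous_snd (X := unitInterval))
      have ht : Continuous fun p : unitInterval × sphere (0 : E) 1 => (p.1 : ℝ) := by fun_prop
      exact ((continuous_const.sub ht).mul (continuous_const.mul this)).add ht
    have hs0 : ∀ p, 0 < s p := by
      intro p
      have h1 := p.1.2.1
      have h2 := p.1.2.2
      have h3 : 0 < r * ‖G (ε • (p.2 : E))‖⁻¹ :=
        mul_pos hr (inv_pos.2 (norm_pos_iff.2 (hu0 _)))
      rcases h2.lt_or_eq with h | h
      · have := mul_pos (sub_pos.2 h) h3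
        simp only [s]; linarith
      · simp [s, h]
    have hsr : ∀ p, s p • G (ε • (p.2 : E)) ∈ closedBall (0 : E) r := by
      intro p
      have h1 := p.1.2.1
      have h2 := p.1.2.2
      have h3 : ‖G (ε • (p.2 : E))‖ ≤ r := by simpa using (hfG _ (hmem p.2)).1
      have h4 : ‖G (ε • (p.2 : E))‖ ≠ 0 := norm_ne_zero_iff.2 (hu0 p.2)
      rw [mem_closedBall_zero_iff, norm_smul, Real.norm_of_nonneg (hs0 p).le]
      have : s p * ‖G (ε • (p.2 : E))‖ = (1 - (p.1 : ℝ)) * r + p.1 * ‖G (ε • (p.2 : E))‖ := by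
        simp only [s]; field_simp
      rw [this]
      nlinarith
    refine homotopic_of_forall_ne_zero (fun p => f (s p • G (ε • (p.2 : E)))) ?_ ?_ ?_ ?_
    · exact hf.comp_continuous (hs.smul (hGc.comp continuous_snd)) hsr
    · exact fun p => hfne _ (hsr p) (smul_ne_zero (hs0 p).ne' (hu0 p.2))
    · intro y
      simp [hφ, hψ, s, smul_smul]
    · intro y
      simp [s, (hfG _ (hmem y)).2, norm_smul, smul_smul, abs_of_pos hε, hε.ne']
  · have hf0c : Filter.Tendsto f (𝓝 0) (𝓝 0) := by
      simpa [ContinuousAt, hf0] using hf.continuousAt (closedBall_mem_nhds (0 : E) hr)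
    obtain ⟨δ', hδ', hδf⟩ := nhds_basis_closedBall.mem_iff.1
      (hf0c (closedBall_mem_nhds (0 : E) hε))
    obtain ⟨δ, hδ, hδr, hδδ⟩ : ∃ δ, 0 < δ ∧ δ ≤ r ∧ δ ≤ δ' :=
      ⟨min r δ', lt_min hr hδ', min_le_left _ _, min_le_right _ _⟩
    let ρ : unitInterval × sphere (0 : E) 1 → ℝ := fun p => (1 - (p.1 : ℝ)) * r + p.1 * δ
    have hρ0 : ∀ p, 0 < ρ p := by
      intro p
      have h1 := p.1.2.1
      have h2 := p.1.2.2
      simp only [ρ]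
      nlinarith
    have hρr : ∀ p, ρ p • (p.2 : E) ∈ closedBall (0 : E) r := by
      intro p
      have h1 := p.1.2.1
      have h2 := p.1.2.2
      rw [mem_closedBall_zero_iff, norm_smul, Real.norm_of_nonneg (hρ0 p).le, hsph, mul_one]
      simp only [ρ]
      nlinarith
    let w : unitInterval × sphere (0 : E) 1 → E := fun p => f (ρ p • (p.2 : E))
    have hw : Continuous w := hf.comp_continuous (by fun_prop) hρr
    have hw0 : ∀ p, w p ≠ 0 := fun p =>
      hfne _ (hρr p) (smul_ne_zero (hρ0 p).ne' (hsph0 p.2))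
    let s : unitInterval × sphere (0 : E) 1 → ℝ := fun p =>
      (1 - (p.1 : ℝ)) * (ε * ‖w p‖⁻¹) + p.1 * min 1 (ε * ‖w p‖⁻¹)
    have hs : Continuous s := by
      have hi : Continuous fun p => ε * ‖w p‖⁻¹ :=
        continuous_const.mul (hw.norm.inv₀ fun y => norm_ne_zero_iff.2 (hw0 y))
      have ht : Continuous fun p : unitInterval × sphere (0 : E) 1 => (p.1 : ℝ) := by fun_prop
      exact ((continuous_const.sub ht).mul hi).add (ht.mul (continuous_const.min hi))
    have hεw : ∀ p, 0 < ε * ‖w p‖⁻¹ := fun p => mul_pos hε (inv_pos.2 (norm_pos_iff.2 (hw0 _)))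
    have hs0 : ∀ p, 0 < s p := by
      intro p
      have h1 := p.1.2.1
      have h2 := p.1.2.2
      have h3 := hεw p
      have h4 : 0 < min 1 (ε * ‖w p‖⁻¹) := lt_min one_pos h3
      simp only [s]
      rcases h2.lt_or_eq with h | h
      · have := mul_pos (sub_pos.2 h) h3
        have := mul_nonneg h1 h4.le
        linarith
      · rw [h]; linarith
    have hsε : ∀ p, s p • w p ∈ closedBall (0 : E) ε := by
      intro p
      have h1 := p.1.2.1
      have h5 : s p ≤ ε * ‖w p‖⁻¹ := by
        have := mul_le_mul_of_nonneg_left (min_le_right 1 (ε * ‖w p‖⁻¹)) h1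
        simp only [s]
        linarith
      rw [mem_closedBall_zero_iff, norm_smul, Real.norm_of_nonneg (hs0 p).le]
      calc s p * ‖w p‖ ≤ ε * ‖w p‖⁻¹ * ‖w p‖ := by gcongr
        _ = ε := by rw [mul_assoc, inv_mul_cancel₀ (norm_ne_zero_iff.2 (hw0 p)), mul_one]
    refine homotopic_of_forall_ne_zero (fun p => G (s p • w p)) (by fun_prop) ?_ ?_ ?_
    · exact fun p => hG0 _ (hsε p) (smul_ne_zero (hs0 p).ne' (hw0 p))
    · intro x
      simp [hφ, hψ, s, w, ρ, smul_smul]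
    · intro x
      have h1 : w (1, x) = f (δ • (x : E)) := by simp [w, ρ]
      have h2 : ‖w (1, x)‖ ≤ ε := by
        have : δ • (x : E) ∈ closedBall (0 : E) δ' := by
          simpa [norm_smul, abs_of_pos hδ] using hδδ
        simpa [h1] using hδf this
      have h3 : s (1, x) = 1 := by
        have h4 : 1 ≤ ε * ‖w (1, x)‖⁻¹ := by
          rwa [← div_eq_mul_inv, one_le_div (norm_pos_iff.2 (hw0 _))]
        simp [s, min_eq_left h4]
      have h5 : δ • (x : E) ∈ closedBall (0 : E) r := by
        simpa [norm_smul, abs_of_pos hδ] using hδr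
      simp [h3, h1, hGf _ h5, norm_smul, smul_smul, abs_of_pos hδ, hδ.ne']

/-- If some nowhere vanishing map of a ball moves boundary points by less than the radius, then
the identity of the unit sphere is homotopic to a constant map. -/
theorem exists_id_homotopic_const {h : E → E} {r : ℝ} (hr : 0 < r)
    (hc : ContinuousOn h (closedBall 0 r)) (hne : ∀ x ∈ closedBall (0 : E) r, h x ≠ 0)
    (hclose : ∀ x ∈ sphere (0 : E) r, ‖h x - x‖ < r) :
    ∃ p, (ContinuousMap.id (sphere (0 : E) 1)).Homotopic (ContinuousMap.const _ p) := by
  have hsph : ∀ x : sphere (0 : E) 1, ‖(x : E)‖ = 1 := fun x => by simp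
  have hmem : ∀ p : unitInterval × sphere (0 : E) 1,
      ((p.1 : ℝ) * r) • (p.2 : E) ∈ closedBall (0 : E) r := by
    intro p
    rw [mem_closedBall_zero_iff, norm_smul, hsph, mul_one,
      Real.norm_of_nonneg (mul_nonneg p.1.2.1 hr.le)]
    exact mul_le_of_le_one_left hr.le p.1.2.2
  have hmem1 : ∀ x : sphere (0 : E) 1, r • (x : E) ∈ sphere (0 : E) r := fun x => by
    simp [norm_smul, abs_of_pos hr]
  have hcr : Continuous fun x : sphere (0 : E) 1 => h (r • (x : E)) :=
    hc.comp_continuous (by fun_prop) fun x => sphere_subset_closedBall (hmem1 x)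
  have h0 : h 0 ≠ 0 := hne 0 (by simp [hr.le])
  have hr0 : ∀ x : sphere (0 : E) 1, h (r • (x : E)) ≠ 0 := fun x =>
    hne _ (sphere_subset_closedBall (hmem1 x))
  obtain ⟨g, hg⟩ := exists_normalization hcr hr0
  refine ⟨⟨‖h 0‖⁻¹ • h 0, by simp [norm_smul, h0]⟩, .trans (g := g) ?_ (.symm ?_)⟩
  · refine homotopic_of_forall_ne_zero
      (fun p => r • (p.2 : E) + (p.1 : ℝ) • (h (r • (p.2 : E)) - r • (p.2 : E))) ?_ ?_ ?_ ?_
    · have hx : Continuous fun p : unitInterval × sphere (0 : E) 1 => r • (p.2 : E) := by fun_prop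
      have ht : Continuous fun p : unitInterval × sphere (0 : E) 1 => (p.1 : ℝ) := by fun_prop
      exact hx.add (ht.smul ((hcr.comp continuous_snd).sub hx))
    · intro p hp
      have h1 : ‖r • (p.2 : E)‖ = r := by simpa using hmem1 p.2
      rw [add_eq_zero_iff_eq_neg] at hp
      rw [hp, norm_neg, norm_smul, Real.norm_of_nonneg p.1.2.1] at h1
      have := hclose _ (hmem1 p.2)
      have := mul_le_of_le_one_left (norm_nonneg (h (r • (p.2 : E)) - r • (p.2 : E))) p.1.2.2
      linarith
    · intro x
      simp [norm_smul, smul_smul, abs_of_pos hr, hr.ne']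
    · intro x
      simp [hg]
  · refine homotopic_of_forall_ne_zero (fun p => h (((p.1 : ℝ) * r) • (p.2 : E))) ?_ ?_ ?_ ?_
    · exact hc.comp_continuous (by fun_prop) hmem
    · exact fun p => hne _ (hmem p)
    · intro x
      simp
    · intro x
      simp [hg]

end Normalization

section Avoidance

variable {E : Type*} [NormedAddCommGroup E] [NormedSpace ℝ E] [FiniteDimensional ℝ E]

/-- A continuous map can be uniformly approximated by a continuous map without zeros on a given
sphere of nonzero radius. -/
theorem Continuous.exists_approx_ne_zero_on_sphere {G : E → E} (hG : Continuous G) {η : ℝ}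
    (hη : 0 < η) (c : E) {ε : ℝ} (hε : ε ≠ 0) :
    ∃ P : E → E, Continuous P ∧ (∀ y, ‖P y - G y‖ < η) ∧ ∀ y ∈ sphere c ε, P y ≠ 0 := by
  obtain ⟨Q, hQ, hQG, -⟩ := hG.exists_contDiff_approx 1 (ε := fun _ => η / 2) continuous_const
    (fun _ => half_pos hη)
  borelize E
  have hnull : MeasureTheory.Measure.addHaar (Q '' sphere c ε) = 0 :=
    MeasureTheory.addHaar_image_eq_zero_of_differentiableOn_of_addHaar_eq_zero _
      (hQ.differentiable (by simp)).differentiableOn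
      (MeasureTheory.Measure.addHaar_sphere_of_ne_zero _ c hε)
  obtain ⟨v, hvη, hv⟩ : ∃ v ∈ ball (0 : E) (η / 2), v ∉ Q '' sphere c ε := by
    by_contra! hcon
    exact (measure_ball_pos MeasureTheory.Measure.addHaar (0 : E) (half_pos hη)).ne'
      (MeasureTheory.measure_mono_null hcon hnull)
  refine ⟨fun y => Q y - v, hQ.continuous.sub continuous_const, fun y => ?_, fun y hy h => ?_⟩
  · have h1 := hQG y
    rw [dist_eq_norm] at h1
    rw [mem_ball_zero_iff] at hvη
    calc ‖Q y - v - G y‖ = ‖(Q y - G y) - v‖ := by congr 1; abel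
      _ ≤ ‖Q y - G y‖ + ‖v‖ := norm_sub_le _ _
      _ < η := by linarith
  · exact hv ⟨y, hy, sub_eq_zero.1 h⟩

/-- If the image of a ball under an embedding fixing the centre is not a neighbourhood of the
centre, then the inverse of the embedding can be perturbed to a map without zeros. -/
theorem exists_ne_zero_of_image_notMem_nhds {f G : E → E} {r : ℝ} (hr : 0 < r)
    (hf : ContinuousOn f (closedBall 0 r)) (hG : Continuous G)
    (hGf : ∀ x ∈ closedBall (0 : E) r, G (f x) = x) (hf0 : f 0 = 0)
    (hnhds : f '' closedBall 0 r ∉ 𝓝 0) :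
    ∃ h : E → E, ContinuousOn h (closedBall 0 r) ∧ (∀ x ∈ closedBall (0 : E) r, h x ≠ 0) ∧
      ∀ x ∈ sphere (0 : E) r, ‖h x - x‖ < r := by
  have hG0 : G 0 = 0 := by simpa [hf0] using hGf 0 (by simp [hr.le])
  obtain ⟨ε', hε', hεG⟩ := nhds_basis_ball.mem_iff.1
    (hG.continuousAt.preimage_mem_nhds (hG0.symm ▸ ball_mem_nhds (0 : E) hr))
  obtain ⟨ε, hε, hεε⟩ : ∃ ε, 0 < ε ∧ 2 * ε = ε' := ⟨ε' / 2, half_pos hε', by ring⟩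
  obtain ⟨c, hcε, hcK⟩ : ∃ c ∈ ball (0 : E) ε, c ∉ f '' closedBall 0 r := by
    by_contra! hcon
    exact hnhds (Filter.mem_of_superset (ball_mem_nhds 0 hε) hcon)
  rw [mem_ball_zero_iff] at hcε
  have hK : IsCompact (f '' closedBall 0 r) := (isCompact_closedBall 0 r).image_of_continuousOn hf
  have hS : IsCompact (f '' closedBall 0 r \ ball c ε) := hK.diff isOpen_ball
  have hGS : ∀ y ∈ f '' closedBall 0 r \ ball c ε, 0 < ‖G y‖ := by
    rintro _ ⟨⟨x, hx, rfl⟩, hxc⟩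
    rw [norm_pos_iff, hGf x hx]
    rintro rfl
    exact hxc (by simpa [hf0] using hcε)
  obtain ⟨δ, hδ, hδG⟩ := hS.exists_forall_le' hG.norm.continuousOn hGS
  obtain ⟨P, hP, hPG, hP0⟩ := hG.exists_approx_ne_zero_on_sphere (lt_min hδ hr) c hε.ne'
  let s : E → ℝ := fun y => max 1 (ε * ‖y - c‖⁻¹)
  have hfar : ∀ y, ε ≤ ‖y - c‖ → c + s y • (y - c) = y := by
    intro y hy
    have : s y = 1 := max_eq_left <| by
      rwa [← div_eq_mul_inv, div_le_one (hε.trans_le hy)]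
    simp [this]
  have hne : ∀ x ∈ closedBall (0 : E) r, f x - c ≠ 0 := fun x hx h =>
    hcK ⟨x, hx, sub_eq_zero.1 h⟩
  refine ⟨fun x => P (c + s (f x) • (f x - c)), ?_, fun x hx => ?_, fun x hx => ?_⟩
  · have h1 : ContinuousOn (fun x => f x - c) (closedBall 0 r) := hf.sub continuousOn_const
    have h2 := h1.norm.inv₀ fun x hx => norm_ne_zero_iff.2 (hne x hx)
    exact hP.comp_continuousOn (continuousOn_const.add
      ((continuousOn_const.sup (continuousOn_const.mul h2)).smul h1))
  · rcases le_total ε ‖f x - c‖ with hle | hle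
    · simp only [hfar _ hle]
      intro h
      have h1 := hPG (f x)
      rw [h, zero_sub, norm_neg] at h1
      have h2 := hδG (f x) ⟨mem_image_of_mem f hx, by simpa [dist_eq_norm] using hle⟩
      exact absurd (h1.trans_le (min_le_left _ _)) h2.not_gt
    · have hpos := norm_pos_iff.2 (hne x hx)
      have hs : s (f x) = ε * ‖f x - c‖⁻¹ := max_eq_right <| by
        rwa [← div_eq_mul_inv, one_le_div hpos]
      apply hP0
      rw [mem_sphere_iff_norm, add_sub_cancel_left, norm_smul, hs, norm_mul, norm_inv, norm_norm,
        Real.norm_of_nonneg hε.le, mul_assoc, inv_mul_cancel₀ hpos.ne', mul_one]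
  · have hxB := sphere_subset_closedBall hx
    have hle : ε ≤ ‖f x - c‖ := by
      by_contra! hlt
      have h1 : f x ∈ ball (0 : E) ε' := by
        rw [mem_ball_zero_iff]
        have := norm_add_le (f x - c) c
        rw [sub_add_cancel] at this
        linarith
      have h2 := hεG h1
      rw [mem_preimage, hGf x hxB, hG0, mem_ball_zero_iff] at h2
      rw [mem_sphere_zero_iff_norm] at hx
      linarith
    have h1 := hPG (f x)
    simp only [hfar _ hle]
    rw [hGf x hxB] at h1
    exact h1.trans_le (min_le_right _ _)

end Avoidance

/-- If `f : Ω → ℝ^m` is a topological embedding with `f(0) = 0` and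
`B̄(0,r) ⊆ Ω`, then the normalized boundary map `φ(x) = f(rx)/|f(rx)|` on the unit sphere has
degree `±1`; equivalently (by Hopf's theorem for self-maps of spheres), `φ` is a homotopy
equivalence. -/
theorem stmt_10 {m : ℕ} (Ω : Set (EuclideanSpace ℝ (Fin m))) (hΩ : IsOpen Ω)
    (h0 : (0 : EuclideanSpace ℝ (Fin m)) ∈ Ω)
    (f : EuclideanSpace ℝ (Fin m) → EuclideanSpace ℝ (Fin m))
    (hf : IsEmbedding (Ω.restrict f)) (hf0 : f 0 = 0)
    (r : ℝ) (hr : 0 < r)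
    (hball : Metric.closedBall (0 : EuclideanSpace ℝ (Fin m)) r ⊆ Ω)
    (φ : C(Metric.sphere (0 : EuclideanSpace ℝ (Fin m)) 1,
          Metric.sphere (0 : EuclideanSpace ℝ (Fin m)) 1))
    (hφ : ∀ x : Metric.sphere (0 : EuclideanSpace ℝ (Fin m)) 1,
      (φ x : EuclideanSpace ℝ (Fin m)) =
        ‖f (r • (x : EuclideanSpace ℝ (Fin m)))‖⁻¹ •
          f (r • (x : EuclideanSpace ℝ (Fin m)))) :
    ∃ ψ : C(Metric.sphere (0 : EuclideanSpace ℝ (Fin m)) 1,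
            Metric.sphere (0 : EuclideanSpace ℝ (Fin m)) 1),
      (φ.comp ψ).Homotopic (ContinuousMap.id _) ∧
      (ψ.comp φ).Homotopic (ContinuousMap.id _) := by
  have hfB : IsClosedEmbedding ((closedBall 0 r).domRestrict f) := by
    have hc : ContinuousOn f (closedBall 0 r) :=
      (continuousOn_iff_continuous_domRestrict.2 hf.continuous).mono hball
    have : CompactSpace (closedBall (0 : EuclideanSpace ℝ (Fin m)) r) :=
      isCompact_iff_compactSpace.1 (isCompact_closedBall 0 r)
    exact (continuousOn_iff_continuous_domRestrict.1 hc).isClosedEmbedding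
      ((injOn_iff_injective.2 hf.injective).mono hball).injective
  have hfc : ContinuousOn f (closedBall 0 r) :=
    continuousOn_iff_continuous_domRestrict.2 hfB.continuous
  obtain ⟨G, hG⟩ := ContinuousMap.exists_extension' hfB
    (⟨Subtype.val, continuous_subtype_val⟩ : C(closedBall (0 : EuclideanSpace ℝ (Fin m)) r, _))
  have hGf : ∀ x ∈ closedBall (0 : EuclideanSpace ℝ (Fin m)) r, G (f x) = x :=
    fun x hx => congrFun hG ⟨x, hx⟩
  by_cases hnhds : f '' closedBall 0 r ∈ 𝓝 0
  · exact exists_homotopyInverse_of_image_mem_nhds hr hfc G.continuous hGf hf0 hnhds φ hφ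
  · obtain ⟨h, hc, hne, hclose⟩ :=
      exists_ne_zero_of_image_notMem_nhds hr hfc G.continuous hGf hf0 hnhds
    obtain ⟨p, hp⟩ := exists_id_homotopic_const hr hc hne hclose
    exact ⟨φ, homotopic_of_id_homotopic_const hp _ _, homotopic_of_id_homotopic_const hp _ _⟩
end
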